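/- arXiv:1802.06247 — 7 statements merged into one kernel-verified Lean document; each statement's English description precedes it below -/
import Mathlib

section
/- Let H̄₀ = a[q₂(q₁² − p₁²) + 2q₁p₁p₂] + (β/2)(q₂q₃ + p₂p₃)(q₁² + p₁²) be the Hamiltonian (1.10) with α = 0, and let F = 4a²(q₃² + p₃²) − aβ[q₃(q₁² − p₁²) + 2q₁p₁p₃] + (β²/16)(q₁² + p₁²)² + β²(q₂q₃ + p₂p₃)². Then for all real parameters a, β, the Poisson bracket {H̄₀, F} vanishes identically on ℝ⁶; i.e., F is a first integral of the Hamiltonian system generated by H̄₀. -/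
/-- The Poisson bracket of two smooth functions on ℝ⁶ with coordinates
`(q₁, q₂, q₃, p₁, p₂, p₃)`:
`{F, G} = Σ_{j=1}^{3} (∂F/∂q_j · ∂G/∂p_j − ∂F/∂p_j · ∂G/∂q_j)`. -/
noncomputable def poissonBracket (F G : ℝ → ℝ → ℝ → ℝ → ℝ → ℝ → ℝ)
    (q1 q2 q3 p1 p2 p3 : ℝ) : ℝ :=
    deriv (fun x => F x q2 q3 p1 p2 p3) q1 * deriv (fun x => G q1 q2 q3 x p2 p3) p1
  - deriv (fun x => F q1 q2 q3 x p2 p3) p1 * deriv (fun x => G x q2 q3 p1 p2 p3) q1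
  + deriv (fun x => F q1 x q3 p1 p2 p3) q2 * deriv (fun x => G q1 q2 q3 p1 x p3) p2
  - deriv (fun x => F q1 q2 q3 p1 x p3) p2 * deriv (fun x => G q1 x q3 p1 p2 p3) q2
  + deriv (fun x => F q1 q2 x p1 p2 p3) q3 * deriv (fun x => G q1 q2 q3 p1 p2 x) p3
  - deriv (fun x => F q1 q2 q3 p1 p2 x) p3 * deriv (fun x => G q1 q2 x p1 p2 p3) q3

/-- The derivative of left multiplication by a constant, in eta-reduced form. -/
theorem deriv_hMul_left (c x : ℝ) : deriv (HMul.hMul c) x = c := by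
  simp

/-- With `H̄₀ = a[q₂(q₁² − p₁²) + 2q₁p₁p₂] + (β/2)(q₂q₃ + p₂p₃)(q₁² + p₁²)`
(the Hamiltonian (1.10) with α = 0) and
`F = 4a²(q₃² + p₃²) − aβ[q₃(q₁² − p₁²) + 2q₁p₁p₃] + (β²/16)(q₁² + p₁²)² + β²(q₂q₃ + p₂p₃)²`,
the Poisson bracket `{H̄₀, F}` vanishes identically on ℝ⁶. -/
theorem poisson_bracket_H0_F_eq_zero (a β : ℝ) (q1 q2 q3 p1 p2 p3 : ℝ) :
    poissonBracket
      (fun q1 q2 q3 p1 p2 p3 =>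
        a * (q2 * (q1 ^ 2 - p1 ^ 2) + 2 * q1 * p1 * p2)
          + β / 2 * (q2 * q3 + p2 * p3) * (q1 ^ 2 + p1 ^ 2))
      (fun q1 q2 q3 p1 p2 p3 =>
        4 * a ^ 2 * (q3 ^ 2 + p3 ^ 2)
          - a * β * (q3 * (q1 ^ 2 - p1 ^ 2) + 2 * q1 * p1 * p3)
          + β ^ 2 / 16 * (q1 ^ 2 + p1 ^ 2) ^ 2
          + β ^ 2 * (q2 * q3 + p2 * p3) ^ 2)
      q1 q2 q3 p1 p2 p3 = 0 := by
  unfold poissonBracket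
  simp (disch := fun_prop) only [deriv_fun_add, deriv_fun_sub, deriv_fun_mul, deriv_fun_pow,
    deriv_const, deriv_id'', deriv_hMul_left]
  ring
end

section
/- Suppose α > 0 and a, β are real. Then the ℂ⁶-valued curve defined for real t > 0 by q₁(t) = p₁(t) = p₂(t) = 0, q₂(t) = 1/√(2αt), q₃(t) = p₃(t) = i/(2√(αt)) is a solution of the Hamiltonian system: q₁' = 2a(q₁p₂ − q₂p₁) + βp₁(q₂q₃ + p₂p₃); p₁' = −2a(q₁q₂ + p₁p₂) − βq₁(q₂q₃ + p₂p₃); q₂' = 2aq₁p₁ + α[p₃(q₂q₃ + p₂p₃) − q₃(p₂q₃ − q₂p₃)] + (β/2)p₃(q₁² + p₁²); p₂' = −a(q₁² − p₁²) − α[q₃(q₂q₃ + p₂p₃) + p₃(p₂q₃ − q₂p₃)] − (β/2)q₃(q₁² + p₁²); q₃' = α[p₂(q₂q₃ + p₂p₃) + q₂(p₂q₃ − q₂p₃)] + (β/2)p₂(q₁² + p₁²); p₃' = −α[q₂(q₂q₃ + p₂p₃) − p₂(p₂q₃ − q₂p₃)] − (β/2)q₂(q₁² + p₁²). -/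
open Complex Real

/-- The `q₂`-component of the particular solution (4.1): `q₂(t) = 1/√(2αt)`. -/
noncomputable def sol4q2 (α t : ℝ) : ℂ := ((1 / Real.sqrt (2 * α * t) : ℝ) : ℂ)

/-- The `q₃`- and `p₃`-components of the particular solution (4.1):
`q₃(t) = p₃(t) = i/(2√(αt))`. -/
noncomputable def sol4q3 (α t : ℝ) : ℂ := Complex.I / (2 * (Real.sqrt (α * t) : ℂ))

/-- For `c > 0`, the function `f(s) = 1/√(cs)` satisfies `f' = -f/(2t)` at each `t > 0`. -/
theorem hasDerivAt_one_div_sqrt_const_mul {c t : ℝ} (hc : 0 < c) (ht : 0 < t) :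
    HasDerivAt (fun s : ℝ => 1 / √(c * s)) (-(1 / √(c * t)) / (2 * t)) t := by
  have hct : 0 < c * t := mul_pos hc ht
  have hs : √(c * t) ≠ 0 := (Real.sqrt_pos.2 hct).ne'
  have hsq : √(c * t) ^ 2 = c * t := Real.sq_sqrt hct.le
  have h := (((hasDerivAt_id t).const_mul c).sqrt hct.ne').fun_inv hs
  simp only [id_eq, mul_one, ← one_div] at h
  refine h.congr_deriv ?_
  rw [hsq]
  field_simp

theorem sol4q2_sq {α t : ℝ} (hα : 0 < α) (ht : 0 < t) :
    sol4q2 α t ^ 2 = 1 / (2 * α * t) := by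
  have h : √(2 * α * t) ^ 2 = 2 * α * t := Real.sq_sqrt (by positivity)
  rw [sol4q2, ← ofReal_pow, div_pow, h]
  push_cast
  ring

theorem sol4q3_eq (α t : ℝ) : sol4q3 α t = I / 2 * ((1 / √(α * t) : ℝ) : ℂ) := by
  rw [sol4q3]
  push_cast
  ring

theorem sol4q3_sq {α t : ℝ} (hα : 0 < α) (ht : 0 < t) :
    sol4q3 α t ^ 2 = -1 / (4 * α * t) := by
  have h : √(α * t) ^ 2 = α * t := Real.sq_sqrt (by positivity)
  rw [sol4q3_eq, mul_pow, div_pow, I_sq, ← ofReal_pow, div_pow, h]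
  push_cast
  ring

theorem hasDerivAt_sol4q2 {α t : ℝ} (hα : 0 < α) (ht : 0 < t) :
    HasDerivAt (fun s : ℝ => sol4q2 α s) (-sol4q2 α t / (2 * t)) t := by
  have h := (hasDerivAt_one_div_sqrt_const_mul (c := 2 * α) (by positivity) ht).ofReal_comp
  refine h.congr_deriv ?_
  rw [sol4q2]
  push_cast
  ring

theorem hasDerivAt_sol4q3 {α t : ℝ} (hα : 0 < α) (ht : 0 < t) :
    HasDerivAt (fun s : ℝ => sol4q3 α s) (-sol4q3 α t / (2 * t)) t := by
  have h := (hasDerivAt_one_div_sqrt_const_mul hα ht).ofReal_comp.const_mul (I / 2)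
  simp only [sol4q3_eq]
  refine h.congr_deriv ?_
  push_cast
  ring

/-- For `α > 0`, the curve `q₁ = p₁ = p₂ = 0`, `q₂ = 1/√(2αt)`,
`q₃ = p₃ = i/(2√(αt))` solves, for `t > 0`, the Hamilton's equations of the
truncated 1 : 2 : 2 resonance normal form (1.10), extended to ℂ⁶. -/
theorem particular_solution_4_1 (a α β : ℝ) (hα : 0 < α) :
    ∀ t : ℝ, 0 < t →
      -- q₁' = 2a(q₁p₂ − q₂p₁) + βp₁(q₂q₃ + p₂p₃), with q₁ = p₁ = p₂ = 0
      HasDerivAt (fun _ : ℝ => (0 : ℂ))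
        (2 * (a : ℂ) * ((0 : ℂ) * 0 - sol4q2 α t * 0)
          + (β : ℂ) * 0 * (sol4q2 α t * sol4q3 α t + 0 * sol4q3 α t)) t ∧
      -- p₁' = −2a(q₁q₂ + p₁p₂) − βq₁(q₂q₃ + p₂p₃)
      HasDerivAt (fun _ : ℝ => (0 : ℂ))
        (-(2 * (a : ℂ)) * ((0 : ℂ) * sol4q2 α t + 0 * 0)
          - (β : ℂ) * 0 * (sol4q2 α t * sol4q3 α t + 0 * sol4q3 α t)) t ∧
      -- q₂' = 2aq₁p₁ + α[p₃(q₂q₃ + p₂p₃) − q₃(p₂q₃ − q₂p₃)] + (β/2)p₃(q₁² + p₁²)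
      HasDerivAt (fun s : ℝ => sol4q2 α s)
        (2 * (a : ℂ) * 0 * 0
          + (α : ℂ) * (sol4q3 α t * (sol4q2 α t * sol4q3 α t + 0 * sol4q3 α t)
              - sol4q3 α t * ((0 : ℂ) * sol4q3 α t - sol4q2 α t * sol4q3 α t))
          + (β : ℂ) / 2 * sol4q3 α t * ((0 : ℂ) ^ 2 + (0 : ℂ) ^ 2)) t ∧
      -- p₂' = −a(q₁² − p₁²) − α[q₃(q₂q₃ + p₂p₃) + p₃(p₂q₃ − q₂p₃)] − (β/2)q₃(q₁² + p₁²)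
      HasDerivAt (fun _ : ℝ => (0 : ℂ))
        (-(a : ℂ) * ((0 : ℂ) ^ 2 - (0 : ℂ) ^ 2)
          - (α : ℂ) * (sol4q3 α t * (sol4q2 α t * sol4q3 α t + 0 * sol4q3 α t)
              + sol4q3 α t * ((0 : ℂ) * sol4q3 α t - sol4q2 α t * sol4q3 α t))
          - (β : ℂ) / 2 * sol4q3 α t * ((0 : ℂ) ^ 2 + (0 : ℂ) ^ 2)) t ∧
      -- q₃' = α[p₂(q₂q₃ + p₂p₃) + q₂(p₂q₃ − q₂p₃)] + (β/2)p₂(q₁² + p₁²)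
      HasDerivAt (fun s : ℝ => sol4q3 α s)
        ((α : ℂ) * ((0 : ℂ) * (sol4q2 α t * sol4q3 α t + 0 * sol4q3 α t)
            + sol4q2 α t * ((0 : ℂ) * sol4q3 α t - sol4q2 α t * sol4q3 α t))
          + (β : ℂ) / 2 * 0 * ((0 : ℂ) ^ 2 + (0 : ℂ) ^ 2)) t ∧
      -- p₃' = −α[q₂(q₂q₃ + p₂p₃) − p₂(p₂q₃ − q₂p₃)] − (β/2)q₂(q₁² + p₁²)
      HasDerivAt (fun s : ℝ => sol4q3 α s)
        (-(α : ℂ) * (sol4q2 α t * (sol4q2 α t * sol4q3 α t + 0 * sol4q3 α t)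
            - (0 : ℂ) * ((0 : ℂ) * sol4q3 α t - sol4q2 α t * sol4q3 α t))
          - (β : ℂ) / 2 * sol4q2 α t * ((0 : ℂ) ^ 2 + (0 : ℂ) ^ 2)) t := by
  intro t ht
  have hα' : (α : ℂ) ≠ 0 := ofReal_ne_zero.2 hα.ne'
  have ht' : (t : ℂ) ≠ 0 := ofReal_ne_zero.2 ht.ne'
  have h₂ : 2 * α * sol4q2 α t * sol4q3 α t ^ 2 = -sol4q2 α t / (2 * t) := by
    rw [sol4q3_sq hα ht]
    field_simp
    ring
  have h₃ : -α * sol4q2 α t ^ 2 * sol4q3 α t = -sol4q3 α t / (2 * t) := by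
    rw [sol4q2_sq hα ht]
    field_simp
  refine ⟨?_, ?_, ?_, ?_, ?_, ?_⟩
  · exact (hasDerivAt_const t (0 : ℂ)).congr_deriv (by ring)
  · exact (hasDerivAt_const t (0 : ℂ)).congr_deriv (by ring)
  · exact (hasDerivAt_sol4q2 hα ht).congr_deriv (by rw [← h₂]; ring)
  · exact (hasDerivAt_const t (0 : ℂ)).congr_deriv (by ring)
  · exact (hasDerivAt_sol4q3 hα ht).congr_deriv (by rw [← h₃]; ring)
  · exact (hasDerivAt_sol4q3 hα ht).congr_deriv (by rw [← h₃]; ring)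
end

section
/- Suppose α ≠ 0, β = 0, and a is real. Then the ℂ⁶-valued curve defined for real t by q₂(t) = 2a/α, q₁(t) = p₁(t) = (a/α)·exp(−(4a²/α)t), q₃(t) = p₃(t) = (i/√2)·q₁(t), p₂(t) = 0 is a solution of the Hamiltonian system: q₁' = 2a(q₁p₂ − q₂p₁); p₁' = −2a(q₁q₂ + p₁p₂); q₂' = 2aq₁p₁ + α[p₃(q₂q₃ + p₂p₃) − q₃(p₂q₃ − q₂p₃)]; p₂' = −a(q₁² − p₁²) − α[q₃(q₂q₃ + p₂p₃) + p₃(p₂q₃ − q₂p₃)]; q₃' = α[p₂(q₂q₃ + p₂p₃) + q₂(p₂q₃ − q₂p₃)]; p₃' = −α[q₂(q₂q₃ + p₂p₃) − p₂(p₂q₃ − q₂p₃)]. -/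
open Complex Real

/-- The `q₁`- and `p₁`-components of the particular solution (5.1):
`q₁(t) = p₁(t) = (a/α)·exp(−(4a²/α)t)`. -/
noncomputable def sol5q1 (a α t : ℝ) : ℂ := ((a / α * Real.exp (-(4 * a ^ 2 / α) * t) : ℝ) : ℂ)

/-- The `q₂`-component of the particular solution (5.1): `q₂ = 2a/α`. -/
noncomputable def sol5q2 (a α : ℝ) : ℂ := ((2 * a / α : ℝ) : ℂ)

/-- The `q₃`- and `p₃`-components of the particular solution (5.1):
`q₃(t) = p₃(t) = (i/√2)·q₁(t)`. -/
noncomputable def sol5q3 (a α t : ℝ) : ℂ := Complex.I / (Real.sqrt 2 : ℂ) * sol5q1 a α t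

theorem sol5q2_mul (a α : ℝ) (hα : α ≠ 0) : (α : ℂ) * sol5q2 a α = 2 * a := by
  rw [sol5q2, ← Complex.ofReal_mul, mul_div_cancel₀ _ hα]
  push_cast
  ring

theorem sol5q3_sq (a α t : ℝ) : sol5q3 a α t ^ 2 = -(sol5q1 a α t ^ 2) / 2 := by
  have h : (Real.sqrt 2 : ℂ) ^ 2 = 2 := by
    rw [← Complex.ofReal_pow, Real.sq_sqrt zero_le_two, Complex.ofReal_ofNat]
  rw [sol5q3, mul_pow, div_pow, Complex.I_sq, h]
  ring

theorem hasDerivAt_sol5q1 (a α t : ℝ) :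
    HasDerivAt (fun s : ℝ => sol5q1 a α s) (-(2 * (a : ℂ)) * sol5q2 a α * sol5q1 a α t) t := by
  have h := ((((hasDerivAt_id t).const_mul (-(4 * a ^ 2 / α))).exp.const_mul (a / α))).ofReal_comp
  refine h.congr_deriv ?_
  simp only [sol5q1, sol5q2, id_eq]
  push_cast
  ring

theorem hasDerivAt_sol5q3 (a α t : ℝ) :
    HasDerivAt (fun s : ℝ => sol5q3 a α s) (-(2 * (a : ℂ)) * sol5q2 a α * sol5q3 a α t) t := by
  refine ((hasDerivAt_sol5q1 a α t).const_mul (Complex.I / (Real.sqrt 2 : ℂ))).congr_deriv ?_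
  rw [sol5q3]
  ring

/-- For `α ≠ 0`, the curve `q₂ = 2a/α`, `q₁ = p₁ = (a/α)exp(−(4a²/α)t)`,
`q₃ = p₃ = (i/√2)q₁`, `p₂ = 0` solves the Hamilton's equations of the
`β = 0` truncated 1 : 2 : 2 resonance normal form, extended to ℂ⁶. -/
theorem particular_solution_5_1 (a α : ℝ) (hα : α ≠ 0) :
    ∀ t : ℝ,
      -- q₁' = 2a(q₁p₂ − q₂p₁), with p₂ = 0, p₁ = q₁, p₃ = q₃
      HasDerivAt (fun s : ℝ => sol5q1 a α s)
        (2 * (a : ℂ) * (sol5q1 a α t * 0 - sol5q2 a α * sol5q1 a α t)) t ∧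
      -- p₁' = −2a(q₁q₂ + p₁p₂)
      HasDerivAt (fun s : ℝ => sol5q1 a α s)
        (-(2 * (a : ℂ)) * (sol5q1 a α t * sol5q2 a α + sol5q1 a α t * 0)) t ∧
      -- q₂' = 2aq₁p₁ + α[p₃(q₂q₃ + p₂p₃) − q₃(p₂q₃ − q₂p₃)]
      HasDerivAt (fun _ : ℝ => sol5q2 a α)
        (2 * (a : ℂ) * sol5q1 a α t * sol5q1 a α t
          + (α : ℂ) * (sol5q3 a α t * (sol5q2 a α * sol5q3 a α t + 0 * sol5q3 a α t)
              - sol5q3 a α t * ((0 : ℂ) * sol5q3 a α t - sol5q2 a α * sol5q3 a α t))) t ∧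
      -- p₂' = −a(q₁² − p₁²) − α[q₃(q₂q₃ + p₂p₃) + p₃(p₂q₃ − q₂p₃)]
      HasDerivAt (fun _ : ℝ => (0 : ℂ))
        (-(a : ℂ) * (sol5q1 a α t ^ 2 - sol5q1 a α t ^ 2)
          - (α : ℂ) * (sol5q3 a α t * (sol5q2 a α * sol5q3 a α t + 0 * sol5q3 a α t)
              + sol5q3 a α t * ((0 : ℂ) * sol5q3 a α t - sol5q2 a α * sol5q3 a α t))) t ∧
      -- q₃' = α[p₂(q₂q₃ + p₂p₃) + q₂(p₂q₃ − q₂p₃)]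
      HasDerivAt (fun s : ℝ => sol5q3 a α s)
        ((α : ℂ) * ((0 : ℂ) * (sol5q2 a α * sol5q3 a α t + 0 * sol5q3 a α t)
            + sol5q2 a α * ((0 : ℂ) * sol5q3 a α t - sol5q2 a α * sol5q3 a α t))) t ∧
      -- p₃' = −α[q₂(q₂q₃ + p₂p₃) − p₂(p₂q₃ − q₂p₃)]
      HasDerivAt (fun s : ℝ => sol5q3 a α s)
        (-(α : ℂ) * (sol5q2 a α * (sol5q2 a α * sol5q3 a α t + 0 * sol5q3 a α t)
            - (0 : ℂ) * ((0 : ℂ) * sol5q3 a α t - sol5q2 a α * sol5q3 a α t))) t := by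
  intro t
  have h1 := hasDerivAt_sol5q1 a α t
  have h3 := hasDerivAt_sol5q3 a α t
  have hq2 := sol5q2_mul a α hα
  have hq3 := sol5q3_sq a α t
  refine ⟨h1.congr_deriv ?_, h1.congr_deriv ?_, (hasDerivAt_const t _).congr_deriv ?_,
    (hasDerivAt_const t _).congr_deriv ?_, h3.congr_deriv ?_, h3.congr_deriv ?_⟩
  · ring
  · ring
  · linear_combination (-2 * sol5q3 a α t ^ 2) * hq2 - 4 * (a : ℂ) * hq3
  · ring
  · linear_combination (sol5q2 a α * sol5q3 a α t) * hq2
  · linear_combination (sol5q2 a α * sol5q3 a α t) * hq2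
end

section
/- Let a, β be real, α > 0, and let V : ℂ⁶ → ℂ⁶ be the polynomial vector field V(q₁,q₂,q₃,p₁,p₂,p₃) = (2a(q₁p₂ − q₂p₁) + βp₁(q₂q₃ + p₂p₃), 2aq₁p₁ + α[p₃(q₂q₃ + p₂p₃) − q₃(p₂q₃ − q₂p₃)] + (β/2)p₃(q₁² + p₁²), α[p₂(q₂q₃ + p₂p₃) + q₂(p₂q₃ − q₂p₃)] + (β/2)p₂(q₁² + p₁²), −2a(q₁q₂ + p₁p₂) − βq₁(q₂q₃ + p₂p₃), −a(q₁² − p₁²) − α[q₃(q₂q₃ + p₂p₃) + p₃(p₂q₃ − q₂p₃)] − (β/2)q₃(q₁² + p₁²), −α[q₂(q₂q₃ + p₂p₃) − p₂(p₂q₃ − q₂p₃)] − (β/2)q₂(q₁² + p₁²)), and let Γ(t) be the particular solution given for t > 0 by q₁ = p₁ = p₂ = 0, q₂ = 1/√(2αt), q₃ = p₃ = i/(2√(αt)). If Ξ : (0,∞) → ℂ⁶ is differentiable and satisfies the variational equation Ξ'(t) = DV(Γ(t))·Ξ(t), where DV(x) denotes the derivative (Jacobian) of V at x, then its q₁- and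 p₁-components ξ₁, η₁ satisfy the closed linear system ξ₁'(t) = [iβ/(2√2·αt) − √2·a/√(αt)]·η₁(t) and η₁'(t) = −[iβ/(2√2·αt) + √2·a/√(αt)]·ξ₁(t) for all t > 0. -/
open Complex Real

/-- The Hamiltonian vector field of the truncated 1 : 2 : 2 resonance normal
form (1.10), extended polynomially to ℂ⁶; the coordinates are ordered as
`x = (q₁, q₂, q₃, p₁, p₂, p₃)` and `V x = (q₁', q₂', q₃', p₁', p₂', p₃')`. -/
noncomputable def hamVF (a α β : ℝ) (x : Fin 6 → ℂ) : Fin 6 → ℂ :=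
  ![2 * (a : ℂ) * (x 0 * x 4 - x 1 * x 3) + (β : ℂ) * x 3 * (x 1 * x 2 + x 4 * x 5),
    2 * (a : ℂ) * x 0 * x 3
      + (α : ℂ) * (x 5 * (x 1 * x 2 + x 4 * x 5) - x 2 * (x 4 * x 2 - x 1 * x 5))
      + (β : ℂ) / 2 * x 5 * (x 0 ^ 2 + x 3 ^ 2),
    (α : ℂ) * (x 4 * (x 1 * x 2 + x 4 * x 5) + x 1 * (x 4 * x 2 - x 1 * x 5))
      + (β : ℂ) / 2 * x 4 * (x 0 ^ 2 + x 3 ^ 2),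
    -(2 * (a : ℂ)) * (x 0 * x 1 + x 3 * x 4) - (β : ℂ) * x 0 * (x 1 * x 2 + x 4 * x 5),
    -(a : ℂ) * (x 0 ^ 2 - x 3 ^ 2)
      - (α : ℂ) * (x 2 * (x 1 * x 2 + x 4 * x 5) + x 5 * (x 4 * x 2 - x 1 * x 5))
      - (β : ℂ) / 2 * x 2 * (x 0 ^ 2 + x 3 ^ 2),
    -(α : ℂ) * (x 1 * (x 1 * x 2 + x 4 * x 5) - x 4 * (x 4 * x 2 - x 1 * x 5))
      - (β : ℂ) / 2 * x 1 * (x 0 ^ 2 + x 3 ^ 2)]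

/-- The particular solution (4.1): `q₁ = p₁ = p₂ = 0`, `q₂ = 1/√(2αt)`,
`q₃ = p₃ = i/(2√(αt))`, in the coordinate order `(q₁, q₂, q₃, p₁, p₂, p₃)`. -/
noncomputable def gamma4 (α t : ℝ) : Fin 6 → ℂ :=
  ![0, ((1 / Real.sqrt (2 * α * t) : ℝ) : ℂ),
    Complex.I / (2 * (Real.sqrt (α * t) : ℂ)), 0, 0,
    Complex.I / (2 * (Real.sqrt (α * t) : ℂ))]

theorem differentiable_hamVF (a α β : ℝ) : Differentiable ℂ (hamVF a α β) := by
  rw [differentiable_pi]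
  intro i
  fin_cases i <;> simp [hamVF] <;> fun_prop

/-- A coordinate of a derivative `DF(x) v` can be read off from a factorization
`F (x + s v) i = s * g s` along the line through `x` in direction `v`. -/
theorem fderiv_apply_eq_of_line_factor {ι : Type*} [Fintype ι] {F : (ι → ℂ) → ι → ℂ}
    {x v : ι → ℂ} {i : ι} (hF : DifferentiableAt ℂ F x) {g : ℂ → ℂ}
    (hg : DifferentiableAt ℂ g 0) (h : ∀ s : ℂ, F (x + s • v) i = s * g s) :
    fderiv ℂ F x v i = g 0 := by
  have hline : HasDerivAt (fun s : ℂ => F (x + s • v)) (fderiv ℂ F x v) 0 :=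
    hF.hasFDerivAt.hasLineDerivAt v
  have h1 := hasDerivAt_pi.1 hline i
  have h2 : HasDerivAt (fun s : ℂ => F (x + s • v) i) (1 * g 0 + 0 * deriv g 0) 0 := by
    simp only [h]
    exact (hasDerivAt_id (0 : ℂ)).mul hg.hasDerivAt
  simpa using h1.unique h2

theorem fderiv_hamVF_apply_zero (a α β : ℝ) (u w v₀ : ℂ) (v : Fin 6 → ℂ) :
    fderiv ℂ (hamVF a α β) ![0, u, w, 0, 0, v₀] v 0 = (β * (u * w) - 2 * a * u) * v 3 := by
  rw [fderiv_apply_eq_of_line_factor (differentiable_hamVF a α β _)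
    (g := fun s => 2 * (a : ℂ) * (s * v 0 * v 4 - (u + s * v 1) * v 3)
      + β * v 3 * ((u + s * v 1) * (w + s * v 2) + s * v 4 * (v₀ + s * v 5)))
    (by fun_prop) (fun s => by simp [hamVF]; ring)]
  ring

theorem fderiv_hamVF_apply_three (a α β : ℝ) (u w v₀ : ℂ) (v : Fin 6 → ℂ) :
    fderiv ℂ (hamVF a α β) ![0, u, w, 0, 0, v₀] v 3 = -(β * (u * w) + 2 * a * u) * v 0 := by
  rw [fderiv_apply_eq_of_line_factor (differentiable_hamVF a α β _)
    (g := fun s => -(2 * (a : ℂ)) * (v 0 * (u + s * v 1) + v 3 * (s * v 4))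
      - β * v 0 * ((u + s * v 1) * (w + s * v 2) + s * v 4 * (v₀ + s * v 5)))
    (by fun_prop) (fun s => by simp [hamVF]; ring)]
  ring

theorem two_mul_one_div_sqrt_two_mul (α t : ℝ) :
    2 * ((1 / Real.sqrt (2 * α * t) : ℝ) : ℂ) = (Real.sqrt 2 : ℂ) / (Real.sqrt (α * t) : ℂ) := by
  have h : 2 * (1 / Real.sqrt (2 * α * t)) = Real.sqrt 2 / Real.sqrt (α * t) := by
    rw [mul_assoc, Real.sqrt_mul zero_le_two, mul_one_div, ← div_div, Real.div_sqrt]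
  exact_mod_cast h

theorem one_div_sqrt_mul_I_div {α t : ℝ} (h : 0 < α * t) :
    ((1 / Real.sqrt (2 * α * t) : ℝ) : ℂ) * (Complex.I / (2 * (Real.sqrt (α * t) : ℂ)))
      = Complex.I / (2 * (Real.sqrt 2 : ℂ) * (α : ℂ) * (t : ℂ)) := by
  have hs : (Real.sqrt (α * t) : ℂ) * (Real.sqrt (α * t) : ℂ) = (α : ℂ) * (t : ℂ) := by
    exact_mod_cast Real.mul_self_sqrt h.le
  rw [mul_assoc 2 α t, Real.sqrt_mul zero_le_two, mul_assoc (2 * (Real.sqrt 2 : ℂ)), ← hs]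
  push_cast
  rw [div_mul_div_comm, one_mul]
  congr 1
  ring

/-- Any solution `Ξ` of the variational equation `Ξ' = DV(Γ(t))·Ξ` along the
particular solution (4.1) has `q₁`- and `p₁`-components `ξ₁ = Ξ 0`, `η₁ = Ξ 3`
satisfying the closed normal variational system (4.4):
`ξ₁' = [iβ/(2√2·αt) − √2·a/√(αt)]·η₁`, `η₁' = −[iβ/(2√2·αt) + √2·a/√(αt)]·ξ₁`. -/
theorem normal_variational_equations (a α β : ℝ) (hα : 0 < α)
    (Ξ : ℝ → (Fin 6 → ℂ))
    (hΞ : ∀ t : ℝ, 0 < t →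
      HasDerivAt Ξ (fderiv ℂ (hamVF a α β) (gamma4 α t) (Ξ t)) t) :
    ∀ t : ℝ, 0 < t →
      HasDerivAt (fun s => Ξ s 0)
        ((Complex.I * (β : ℂ) / (2 * (Real.sqrt 2 : ℂ) * (α : ℂ) * (t : ℂ))
          - (Real.sqrt 2 : ℂ) * (a : ℂ) / ((Real.sqrt (α * t) : ℝ) : ℂ)) * Ξ t 3) t ∧
      HasDerivAt (fun s => Ξ s 3)
        (-(Complex.I * (β : ℂ) / (2 * (Real.sqrt 2 : ℂ) * (α : ℂ) * (t : ℂ))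
          + (Real.sqrt 2 : ℂ) * (a : ℂ) / ((Real.sqrt (α * t) : ℝ) : ℂ)) * Ξ t 0) t := by
  intro t ht
  have hd := hasDerivAt_pi.1 (hΞ t ht)
  have hu := two_mul_one_div_sqrt_two_mul α t
  have huw := one_div_sqrt_mul_I_div (mul_pos hα ht)
  constructor
  · refine (hd 0).congr_deriv ?_
    unfold gamma4
    rw [fderiv_hamVF_apply_zero, huw]
    linear_combination -(a : ℂ) * Ξ t 3 * hu
  · refine (hd 3).congr_deriv ?_
    unfold gamma4
    rw [fderiv_hamVF_apply_three, huw]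
    linear_combination -(a : ℂ) * Ξ t 0 * hu
end

section
/- Let a, α be real with α ≠ 0, and define q₁(t) = (a/α)·exp(−(4a²/α)t), q₂ = 2a/α, q₃(t) = (i/√2)·q₁(t). Suppose v₁, η₂, v₃ : ℝ → ℂ are differentiable and satisfy the variational system v₁' = 2a·q₂·v₁ + 4a·q₁·η₂, η₂' = −2a·q₁·v₁ − 2α·q₃²·η₂ − 2α·q₂·q₃·v₃, v₃' = α·q₂²·v₃ + 4α·q₂·q₃·η₂. Then the function t ↦ q₁(t)·v₁(t) + q₃(t)·v₃(t) is constant on ℝ. -/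
open Complex Real

/-- Along the particular solution (5.1) of the `β = 0` truncated 1 : 2 : 2
resonance normal form, with `q₁(t) = (a/α)exp(−(4a²/α)t)`, `q₂ = 2a/α`,
`q₃(t) = (i/√2)q₁(t)`, any solution `(v₁, η₂, v₃)` of the variational system
(5.2) conserves the quantity `q₁v₁ + q₃v₃` (the linearization of the
Hamiltonian along the solution). -/
theorem variational_system_integral (a α : ℝ) (hα : α ≠ 0)
    (q1 q3 : ℝ → ℂ)
    (hq1 : ∀ t : ℝ, q1 t = ((a / α * Real.exp (-(4 * a ^ 2 / α) * t) : ℝ) : ℂ))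
    (hq3 : ∀ t : ℝ, q3 t = Complex.I / (Real.sqrt 2 : ℂ) * q1 t)
    (q2 : ℂ) (hq2 : q2 = ((2 * a / α : ℝ) : ℂ))
    (v1 η2 v3 : ℝ → ℂ)
    (hv1 : ∀ t : ℝ, HasDerivAt v1 (2 * (a : ℂ) * q2 * v1 t + 4 * (a : ℂ) * q1 t * η2 t) t)
    (hη2 : ∀ t : ℝ, HasDerivAt η2
      (-(2 * (a : ℂ)) * q1 t * v1 t - 2 * (α : ℂ) * q3 t ^ 2 * η2 t
        - 2 * (α : ℂ) * q2 * q3 t * v3 t) t)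
    (hv3 : ∀ t : ℝ, HasDerivAt v3
      ((α : ℂ) * q2 ^ 2 * v3 t + 4 * (α : ℂ) * q2 * q3 t * η2 t) t) :
    ∃ c : ℂ, ∀ t : ℝ, q1 t * v1 t + q3 t * v3 t = c := by
  have hα' : (α : ℂ) ≠ 0 := Complex.ofReal_ne_zero.mpr hα
  have hdq1 : ∀ t : ℝ, HasDerivAt q1 (-(4 * (a : ℂ) ^ 2 / α) * q1 t) t := by
    intro t
    have hlin : HasDerivAt (fun s : ℝ => -(4 * a ^ 2 / α) * s) (-(4 * a ^ 2 / α)) t := by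
      simpa using (hasDerivAt_id t).const_mul (-(4 * a ^ 2 / α))
    rw [funext hq1]
    refine (hlin.exp.const_mul (a / α)).ofReal_comp.congr_deriv ?_
    push_cast
    ring
  have hdq3 : ∀ t : ℝ, HasDerivAt q3 (-(4 * (a : ℂ) ^ 2 / α) * q3 t) t := by
    intro t
    rw [funext hq3]
    refine ((hdq1 t).const_mul (Complex.I / (Real.sqrt 2 : ℂ))).congr_deriv ?_
    ring
  have hsq : ∀ t : ℝ, q1 t ^ 2 + 2 * q3 t ^ 2 = 0 := by
    intro t
    have h2 : (Real.sqrt 2 : ℂ) ^ 2 = 2 := by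
      exact_mod_cast Real.sq_sqrt (zero_le_two : (0 : ℝ) ≤ 2)
    rw [hq3, mul_pow, div_pow, Complex.I_sq, h2]
    ring
  have hderiv : ∀ t : ℝ, HasDerivAt (fun s => q1 s * v1 s + q3 s * v3 s) 0 t := by
    intro t
    refine (((hdq1 t).mul (hv1 t)).add ((hdq3 t).mul (hv3 t))).congr_deriv ?_
    rw [hq2]
    push_cast
    field_simp
    linear_combination (4 * (a : ℂ) * α * η2 t) * hsq t
  exact ⟨_, fun t => is_const_of_deriv_eq_zero (fun s => (hderiv s).differentiableAt)
    (fun s => (hderiv s).deriv) t 0⟩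
end

section
/- Let a, α be real with a ≠ 0 and α ≠ 0, and define q₁(t) = (a/α)·exp(−(4a²/α)t), q₂ = 2a/α, q₃(t) = (i/√2)·q₁(t). Suppose v₁, η₂, v₃ : ℝ → ℂ are differentiable, satisfy v₁' = 2a·q₂·v₁ + 4a·q₁·η₂, η₂' = −2a·q₁·v₁ − 2α·q₃²·η₂ − 2α·q₂·q₃·v₃, v₃' = α·q₂²·v₃ + 4α·q₂·q₃·η₂, and in addition q₁(t)·v₁(t) + q₃(t)·v₃(t) = 0 for all t. Then (v₁, η₂) satisfies the reduced system v₁'(t) = (4a²/α)·[v₁(t) + exp(−(4a²/α)t)·η₂(t)] and η₂'(t) = (2a²/α)·exp(−(4a²/α)t)·v₁(t) + (a²/α)·exp(−(8a²/α)t)·η₂(t) for all t ∈ ℝ. -/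
open Complex Real

/-- Along the particular solution (5.1) of the `β = 0` truncated 1 : 2 : 2
resonance normal form, with `q₁(t) = (a/α)exp(−(4a²/α)t)`, `q₂ = 2a/α`,
`q₃(t) = (i/√2)q₁(t)`, any solution `(v₁, η₂, v₃)` of the variational system
(5.2) that additionally satisfies `q₁v₁ + q₃v₃ = 0` has `(v₁, η₂)` obeying the
reduced system (5.4):
`v₁' = (4a²/α)[v₁ + exp(−(4a²/α)t)·η₂]`,
`η₂' = (2a²/α)exp(−(4a²/α)t)·v₁ + (a²/α)exp(−(8a²/α)t)·η₂`. -/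
theorem reduced_variational_system (a α : ℝ) (ha : a ≠ 0) (hα : α ≠ 0)
    (q1 q3 : ℝ → ℂ)
    (hq1 : ∀ t : ℝ, q1 t = ((a / α * Real.exp (-(4 * a ^ 2 / α) * t) : ℝ) : ℂ))
    (hq3 : ∀ t : ℝ, q3 t = Complex.I / (Real.sqrt 2 : ℂ) * q1 t)
    (q2 : ℂ) (hq2 : q2 = ((2 * a / α : ℝ) : ℂ))
    (v1 η2 v3 : ℝ → ℂ)
    (hv1 : ∀ t : ℝ, HasDerivAt v1 (2 * (a : ℂ) * q2 * v1 t + 4 * (a : ℂ) * q1 t * η2 t) t)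
    (hη2 : ∀ t : ℝ, HasDerivAt η2
      (-(2 * (a : ℂ)) * q1 t * v1 t - 2 * (α : ℂ) * q3 t ^ 2 * η2 t
        - 2 * (α : ℂ) * q2 * q3 t * v3 t) t)
    (hv3 : ∀ t : ℝ, HasDerivAt v3
      ((α : ℂ) * q2 ^ 2 * v3 t + 4 * (α : ℂ) * q2 * q3 t * η2 t) t)
    (hzero : ∀ t : ℝ, q1 t * v1 t + q3 t * v3 t = 0) :
    ∀ t : ℝ,
      HasDerivAt v1
        ((4 * (a : ℂ) ^ 2 / (α : ℂ)) *
          (v1 t + ((Real.exp (-(4 * a ^ 2 / α) * t) : ℝ) : ℂ) * η2 t)) t ∧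
      HasDerivAt η2
        ((2 * (a : ℂ) ^ 2 / (α : ℂ)) * ((Real.exp (-(4 * a ^ 2 / α) * t) : ℝ) : ℂ) * v1 t
          + ((a : ℂ) ^ 2 / (α : ℂ)) * ((Real.exp (-(8 * a ^ 2 / α) * t) : ℝ) : ℂ) * η2 t) t := by
  intro t
  have hα' : (α : ℂ) ≠ 0 := by exact_mod_cast hα
  have hsq : q3 t ^ 2 = -(q1 t ^ 2) / 2 := by
    have h2 : (Real.sqrt 2 : ℂ) ^ 2 = 2 := by
      exact_mod_cast Real.sq_sqrt (zero_le_two : (0 : ℝ) ≤ 2)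
    rw [hq3, mul_pow, div_pow, Complex.I_sq, h2]
    ring
  have hexp : Real.exp (-(8 * a ^ 2 / α) * t) = Real.exp (-(4 * a ^ 2 / α) * t) ^ 2 := by
    rw [← Real.exp_nat_mul]
    congr 1
    push_cast
    ring
  have hv3_elim : q3 t * v3 t = -(q1 t * v1 t) := by linear_combination hzero t
  constructor
  · convert hv1 t using 1
    rw [hq1, hq2]
    push_cast
    ring
  · convert hη2 t using 1
    rw [hsq, mul_assoc _ (q3 t), hv3_elim, hexp, hq1, hq2]
    push_cast
    field_simp
    ring
end

section
/- Let g : (0,∞) → ℂ be differentiable with g'(z) = exp(−z²/8)/z for all z > 0. Then the two pairs of functions (v₁, η₂) given by v₁(z) = −z/2, η₂(z) = 1, and by v₁(z) = −2·exp(−z²/8)/z − (z/2)·g(z), η₂(z) = g(z), each satisfy the system v₁'(z) = −(1/z)·v₁(z) − η₂(z) and η₂'(z) = −(1/2)·v₁(z) − (z/4)·η₂(z) for all z > 0. -/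
open Complex Real

/-- The two columns of the fundamental matrix (5.6): with `g' (z) = exp(−z²/8)/z`,
both `(v₁, η₂) = (−z/2, 1)` and
`(v₁, η₂) = (−2·exp(−z²/8)/z − (z/2)·g(z), g(z))` solve the algebraic-form
system (5.5): `v₁' = −(1/z)v₁ − η₂`, `η₂' = −(1/2)v₁ − (z/4)η₂` on `(0,∞)`. -/
theorem fundamental_solutions (g : ℝ → ℂ)
    (hg : ∀ z : ℝ, 0 < z →
      HasDerivAt g (((Real.exp (-(z ^ 2) / 8) : ℝ) : ℂ) / (z : ℂ)) z) :
    ∀ z : ℝ, 0 < z →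
      -- first pair: v₁(z) = −z/2, η₂(z) = 1
      (HasDerivAt (fun w : ℝ => -((w : ℂ) / 2))
        (-(1 / (z : ℂ)) * (-((z : ℂ) / 2)) - 1) z ∧
      HasDerivAt (fun _ : ℝ => (1 : ℂ))
        (-(1 / 2 : ℂ) * (-((z : ℂ) / 2)) - ((z : ℂ) / 4) * 1) z) ∧
      -- second pair: v₁(z) = −2·exp(−z²/8)/z − (z/2)·g(z), η₂(z) = g(z)
      (HasDerivAt (fun w : ℝ =>
          -2 * ((Real.exp (-(w ^ 2) / 8) : ℝ) : ℂ) / (w : ℂ) - (w : ℂ) / 2 * g w)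
        (-(1 / (z : ℂ)) *
            (-2 * ((Real.exp (-(z ^ 2) / 8) : ℝ) : ℂ) / (z : ℂ) - (z : ℂ) / 2 * g z)
          - g z) z ∧
      HasDerivAt g
        (-(1 / 2 : ℂ) *
            (-2 * ((Real.exp (-(z ^ 2) / 8) : ℝ) : ℂ) / (z : ℂ) - (z : ℂ) / 2 * g z)
          - ((z : ℂ) / 4) * g z) z) := by
  intro z hz
  have hz' : (z : ℂ) ≠ 0 := by exact_mod_cast hz.ne'
  have hid : HasDerivAt (fun w : ℝ => (w : ℂ)) 1 z := (hasDerivAt_id z).ofReal_comp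
  have hexp : HasDerivAt (fun w : ℝ => ((Real.exp (-(w ^ 2) / 8) : ℝ) : ℂ))
      (-((z : ℂ) / 4) * ((Real.exp (-(z ^ 2) / 8) : ℝ) : ℂ)) z := by
    refine (((hasDerivAt_pow 2 z).neg.div_const 8).exp).ofReal_comp.congr_deriv ?_
    simp only [Pi.neg_apply]
    push_cast
    ring
  refine ⟨⟨?_, ?_⟩, ?_, ?_⟩
  · refine (hid.div_const 2).neg.congr_deriv ?_
    field_simp
    ring
  · refine (hasDerivAt_const z (1 : ℂ)).congr_deriv ?_
    ring
  · refine (((hexp.const_mul (-2)).div hid hz').sub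
      ((hid.div_const 2).mul (hg z hz))).congr_deriv ?_
    field_simp
    ring
  · refine (hg z hz).congr_deriv ?_
    field_simp
    ring
end
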